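/- Combinatorial characterization of the optimal maximum workload (uniform case): Assume the uniform case, i.e. there are μ_i > 0 with μ_{ij} = μ_i for every j ∼ i, and λ_j = λ > 0 for every j ∈ J. For a nonempty S ⊆ J let ∂(S) := { i ∈ I : ∃ j ∈ S with i ∼ j }, λ(S) := λ · |S|, and μ(S) := ∑_{i ∈ ∂(S)} μ_i. Then η_s* = max over nonempty S ⊆ J of λ(S)/μ(S). -/

import Mathlib

open Finset

/-- The workload of worker `i` under allocation `x`:
`ρ_i(x) = ∑_{ℓ ∼ i} x_{iℓ} λ_ℓ / μ_{iℓ}`. -/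
noncomputable def rho {I J : Type*} [Fintype J] (E : I → J → Prop)
    [∀ i j, Decidable (E i j)] (lam : J → ℝ) (mu : I → J → ℝ)
    (x : I → J → ℝ) (i : I) : ℝ :=
  ∑ l ∈ univ.filter (fun l => E i l), x i l * lam l / mu i l

/-- Feasibility of an allocation `x` for the instance `(I, J, E, λ, μ)`. -/
def Feasible {I J : Type*} [Fintype I] [Fintype J] (E : I → J → Prop)
    [∀ i j, Decidable (E i j)] (lam : J → ℝ) (mu : I → J → ℝ)
    (x : I → J → ℝ) : Prop :=
  (∀ i j, ¬ E i j → x i j = 0) ∧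
  (∀ i j, 0 ≤ x i j ∧ x i j ≤ 1) ∧
  (∀ j, ∑ i ∈ univ.filter (fun i => E i j), x i j = 1) ∧
  (∀ i, rho E lam mu x i ≤ 1)

/-- Strict feasibility: feasibility plus `ρ_i(x) < 1` for every worker. -/
def StrictFeasible {I J : Type*} [Fintype I] [Fintype J] (E : I → J → Prop)
    [∀ i j, Decidable (E i j)] (lam : J → ℝ) (mu : I → J → ℝ)
    (x : I → J → ℝ) : Prop :=
  Feasible E lam mu x ∧ ∀ i, rho E lam mu x i < 1

/-- Expected relative waiting time of task type `j` under allocation `x`. -/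
noncomputable def wbar {I J : Type*} [Fintype I] [Fintype J] (E : I → J → Prop)
    [∀ i j, Decidable (E i j)] (lam : J → ℝ) (mu : I → J → ℝ)
    (x : I → J → ℝ) (j : J) : ℝ :=
  ∑ i ∈ univ.filter (fun i => E i j),
    x i j * mu i j *
      ((∑ l ∈ univ.filter (fun l => E i l), x i l * lam l / (mu i l) ^ 2) /
        (1 - ∑ l ∈ univ.filter (fun l => E i l), x i l * lam l / mu i l))

/-- Optimal value `η_s*` of Program P_B: the infimum over feasible `x`
of the maximum workload. -/
noncomputable def etaS {I J : Type*} [Fintype I] [Fintype J] (E : I → J → Prop)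
    [∀ i j, Decidable (E i j)] (lam : J → ℝ) (mu : I → J → ℝ) : ℝ :=
  sInf ((fun x => ⨆ i, rho E lam mu x i) '' {x | Feasible E lam mu x})

/-- Optimal value `η_t*` of Program P_A: the infimum over strictly feasible `x`
of the maximum relative waiting time. -/
noncomputable def etaT {I J : Type*} [Fintype I] [Fintype J] (E : I → J → Prop)
    [∀ i j, Decidable (E i j)] (lam : J → ℝ) (mu : I → J → ℝ) : ℝ :=
  sInf ((fun x => ⨆ j, wbar E lam mu x j) '' {x | StrictFeasible E lam mu x})

/-- Optimal value `η̄_t*` of Program P̄_A (the simplified program in the uniform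
case): the infimum over strictly feasible `x` of
`max_j ((∑_{i ∼ j} x_{ij}/(1 − ρ_i(x))) − 1)`. -/
noncomputable def etaTbar {I J : Type*} [Fintype I] [Fintype J] (E : I → J → Prop)
    [∀ i j, Decidable (E i j)] (lam : J → ℝ) (mu : I → J → ℝ) : ℝ :=
  sInf ((fun x => ⨆ j,
    (∑ i ∈ univ.filter (fun i => E i j), x i j / (1 - rho E lam mu x i)) - 1) ''
      {x | StrictFeasible E lam mu x})

/-- Existence of a balanced fractional assignment. -/
theorem exists_balanced {I J : Type*} [Fintype I] [Fintype J] (E : I → J → Prop)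
    (m : I → ℝ) (hm : ∀ i, 0 < m i)
    (x0 : I → J → ℝ) (h0 : ∀ i j, 0 ≤ x0 i j) (h0E : ∀ i j, ¬ E i j → x0 i j = 0)
    (h0s : ∀ j, ∑ i, x0 i j = 1) :
    ∃ x : I → J → ℝ, (∀ i j, 0 ≤ x i j) ∧ (∀ i j, ¬ E i j → x i j = 0) ∧
      (∀ j, ∑ i, x i j = 1) ∧
      ∀ i j k, 0 < x i j → E k j → (∑ l, x i l) / m i ≤ (∑ l, x k l) / m k := by
  classical
  let K : Set (I → J → ℝ) := {x | (∀ i j, 0 ≤ x i j) ∧ (∀ i j, ¬ E i j → x i j = 0) ∧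
      (∀ j, ∑ i, x i j = 1)}
  have hKc : IsCompact K := by
    apply IsCompact.of_isClosed_subset (isCompact_Icc (a := (0 : I → J → ℝ)) (b := 1))
    · have e : K = (⋂ i, ⋂ j, {x : I → J → ℝ | 0 ≤ x i j}) ∩
          ((⋂ i, ⋂ j, ⋂ (_ : ¬ E i j), {x : I → J → ℝ | x i j = 0}) ∩
          (⋂ j, {x : I → J → ℝ | ∑ i, x i j = 1})) := by
        ext x; simp [K]
      rw [e]
      refine IsClosed.inter ?_ (IsClosed.inter ?_ ?_)
      · exact isClosed_iInter fun i => isClosed_iInter fun j =>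
          isClosed_le (by fun_prop) (by fun_prop)
      · exact isClosed_iInter fun i => isClosed_iInter fun j => isClosed_iInter fun _ =>
          isClosed_eq (by fun_prop) (by fun_prop)
      · exact isClosed_iInter fun j => isClosed_eq (by fun_prop) (by fun_prop)
    · rintro x ⟨h1, h2, h3⟩
      refine ⟨fun i j => h1 i j, fun i j => ?_⟩
      have := Finset.single_le_sum (f := fun i => x i j) (fun i _ => h1 i j) (Finset.mem_univ i)
      rw [h3 j] at this
      exact this
  obtain ⟨x, hxK, hmin⟩ := hKc.exists_isMinOn ⟨x0, h0, h0E, h0s⟩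
    (f := fun x : I → J → ℝ => ∑ i, (∑ l, x i l) ^ 2 / m i) (by fun_prop)
  obtain ⟨h1, h2, h3⟩ := hxK
  refine ⟨x, h1, h2, h3, ?_⟩
  intro i j k hij hkj
  by_contra! hlt
  have hik : i ≠ k := by
    rintro rfl
    exact lt_irrefl _ hlt
  have hEij : E i j := by
    by_contra h
    rw [h2 i j h] at hij
    exact lt_irrefl _ hij
  set fi := ∑ l, x i l with hfi
  set fk := ∑ l, x k l with hfk
  have hmi := hm i
  have hmk := hm k
  set c := 1 / m i + 1 / m k with hc
  have hcpos : 0 < c := by positivity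
  set ε := min (x i j) ((fi / m i - fk / m k) / c) with hε
  have hεpos : 0 < ε := lt_min hij (div_pos (by linarith) hcpos)
  have hε1 : ε ≤ x i j := min_le_left _ _
  have hε2 : ε * c ≤ fi / m i - fk / m k := (le_div_iff₀ hcpos).1 (min_le_right _ _)
  let y : I → J → ℝ := fun a b =>
    x a b + (if b = j then (if a = k then ε else 0) - (if a = i then ε else 0) else 0)
  have hyK : y ∈ K := by
    refine ⟨fun a b => ?_, fun a b hab => ?_, fun b => ?_⟩
    · have := h1 a b
      simp only [y]
      split_ifs with hb ha ha' ha' <;> subst_vars <;> first | linarith | skip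
    · have := h2 a b hab
      simp only [y]
      split_ifs with hb ha ha' ha' <;> subst_vars <;> first | contradiction | linarith
    · simp only [y, Finset.sum_add_distrib, h3 b]
      split_ifs <;> simp
  have hrow : ∀ a, ∑ l, y a l =
      ∑ l, x a l + ((if a = k then ε else 0) - (if a = i then ε else 0)) := by
    intro a
    simp only [y, Finset.sum_add_distrib]
    simp
  have hle := hmin hyK
  simp only [Set.mem_setOf_eq, hrow] at hle
  have hdiff : ∑ a, (∑ l, x a l + ((if a = k then ε else 0) - (if a = i then ε else 0))) ^ 2 / m a
      = ∑ a, (∑ l, x a l) ^ 2 / m a + (2 * ε * fk + ε ^ 2) / m k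
        + (-2 * ε * fi + ε ^ 2) / m i := by
    have : ∀ a, (∑ l, x a l + ((if a = k then ε else 0) - (if a = i then ε else 0))) ^ 2 / m a
      = (∑ l, x a l) ^ 2 / m a + (if a = k then (2 * ε * fk + ε ^ 2) / m k else 0)
        + (if a = i then (-2 * ε * fi + ε ^ 2) / m i else 0) := by
      intro a
      by_cases ha : a = k
      · subst ha
        simp only [if_true, if_neg (Ne.symm hik), ← hfk]
        ring
      · by_cases ha' : a = i
        · subst ha'
          simp only [if_true, if_neg ha, ← hfi]
          ring
        · simp [ha, ha']
    simp only [this, Finset.sum_add_distrib]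
    simp
  rw [hdiff] at hle
  have e : (2 * ε * fk + ε ^ 2) / m k + (-2 * ε * fi + ε ^ 2) / m i
      = ε * (ε * c - 2 * (fi / m i - fk / m k)) := by
    rw [hc]; ring
  have : ε * (ε * c - 2 * (fi / m i - fk / m k)) < 0 :=
    mul_neg_of_pos_of_neg hεpos (by linarith)
  linarith

/-- **Combinatorial characterization of the optimal maximum workload (uniform
case).** If the infimum defining `η_s*` is attained, then
`η_s* = max_{∅ ≠ S ⊆ J} λ(S)/μ(S)` where `λ(S) = λ·|S|` and
`μ(S) = ∑_{i ∈ ∂(S)} μ_i`. -/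
theorem etaS_eq_max_ratio_uniform
    {I J : Type*} [Fintype I] [Fintype J] [Nonempty I] [Nonempty J]
    (E : I → J → Prop) [∀ i j, Decidable (E i j)]
    (lam : J → ℝ) (mu : I → J → ℝ)
    (hlam : ∀ j, 0 < lam j) (hmu : ∀ i j, E i j → 0 < mu i j)
    (hEj : ∀ j, ∃ i, E i j) (hEi : ∀ i, ∃ j, E i j)
    (lam0 : ℝ) (hlam0 : 0 < lam0) (hlamu : ∀ j, lam j = lam0)
    (mui : I → ℝ) (hmui : ∀ i, 0 < mui i)
    (hmuu : ∀ i j, E i j → mu i j = mui i)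
    (hattain : ∃ x, Feasible E lam mu x ∧ (⨆ i, rho E lam mu x i) = etaS E lam mu) :
    etaS E lam mu = ⨆ S : {S : Finset J // S.Nonempty},
      (lam0 * S.1.card) /
        ∑ i ∈ univ.filter (fun i => ∃ j ∈ S.1, E i j), mui i := by
  classical
  have hrho : ∀ x : I → J → ℝ, (∀ i j, ¬ E i j → x i j = 0) → ∀ i,
      rho E lam mu x i = lam0 * ((∑ l, x i l) / mui i) := by
    intro x hx i
    unfold rho
    rw [Finset.sum_filter, Finset.sum_div, Finset.mul_sum]
    refine Finset.sum_congr rfl fun l _ => ?_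
    split_ifs with h
    · rw [hlamu, hmuu i l h]; ring
    · rw [hx i l h]; simp
  have hcol : ∀ x : I → J → ℝ, (∀ i j, ¬ E i j → x i j = 0) → ∀ j,
      ∑ i ∈ univ.filter (fun i => E i j), x i j = ∑ i, x i j := by
    intro x hx j
    rw [Finset.sum_filter]
    refine Finset.sum_congr rfl fun i _ => ?_
    split_ifs with h
    · rfl
    · exact (hx i j h).symm
  have hpos : ∀ S : Finset J, S.Nonempty →
      0 < ∑ i ∈ univ.filter (fun i => ∃ j ∈ S, E i j), mui i := by
    rintro S ⟨j, hj⟩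
    obtain ⟨i, hi⟩ := hEj j
    exact Finset.sum_pos (fun i _ => hmui i) ⟨i, by simp; exact ⟨j, hj, hi⟩⟩
  have hbdd : ∀ x : I → J → ℝ, BddAbove (Set.range fun i => rho E lam mu x i) :=
    fun x => (Set.finite_range _).bddAbove
  -- lower bound
  have hlow : ∀ x, Feasible E lam mu x → ∀ S : Finset J, S.Nonempty →
      (lam0 * S.card) / ∑ i ∈ univ.filter (fun i => ∃ j ∈ S, E i j), mui i
        ≤ ⨆ i, rho E lam mu x i := by
    rintro x ⟨hx0, hx1, hx2, -⟩ S hS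
    rw [div_le_iff₀ (hpos S hS), Finset.mul_sum]
    have a1 : ∀ i, lam0 * ∑ l ∈ S, x i l ≤ (⨆ i, rho E lam mu x i) * mui i := by
      intro i
      have := le_ciSup (hbdd x) i
      have h2 : lam0 * ∑ l, x i l = rho E lam mu x i * mui i := by
        rw [hrho x hx0]; have := (hmui i).ne'; field_simp
      have h3 : ∑ l ∈ S, x i l ≤ ∑ l, x i l :=
        Finset.sum_le_sum_of_subset_of_nonneg (Finset.subset_univ _) fun l _ _ => (hx1 i l).1
      calc lam0 * ∑ l ∈ S, x i l ≤ lam0 * ∑ l, x i l := by gcongr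
        _ = rho E lam mu x i * mui i := h2
        _ ≤ _ := mul_le_mul_of_nonneg_right this (hmui i).le
    refine le_trans (le_of_eq ?_) (Finset.sum_le_sum fun i _ => a1 i)
    rw [← Finset.mul_sum, Finset.sum_comm]
    congr 1
    have : ∀ l ∈ S, ∑ i ∈ univ.filter (fun i => ∃ j ∈ S, E i j), x i l = 1 := by
      intro l hl
      rw [← hx2 l, hcol x hx0, Finset.sum_filter]
      refine Finset.sum_congr rfl fun i _ => ?_
      split_ifs with h
      · rfl
      · exact (hx0 i l fun hE => h ⟨l, hl, hE⟩).symm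
    rw [Finset.sum_congr rfl this]
    simp
  obtain ⟨x0, hx0, hx0e⟩ := hattain
  obtain ⟨j0⟩ := ‹Nonempty J›
  haveI : Nonempty {S : Finset J // S.Nonempty} := ⟨⟨{j0}, by simp⟩⟩
  apply le_antisymm
  · obtain ⟨x, h1, h2, h3, h4⟩ := exists_balanced E mui hmui x0 (fun i j => (hx0.2.1 i j).1)
      hx0.1 (fun j => by rw [← hcol x0 hx0.1, hx0.2.2.1])
    obtain ⟨i0, hi0⟩ := Finite.exists_max fun i => (∑ l, x i l) / mui i
    set M := (∑ l, x i0 l) / mui i0 with hM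
    set A := univ.filter fun i => (∑ l, x i l) / mui i = M with hA
    set S := univ.filter fun j => ∃ i ∈ A, 0 < x i j with hSdef
    have hMpos : 0 < M := by
      obtain ⟨i, -, hi⟩ : ∃ i ∈ univ, 0 < x i j0 := by
        apply Finset.exists_lt_of_sum_lt
        rw [h3 j0]; simp
      have : 0 < ∑ l, x i l := lt_of_lt_of_le hi
        (Finset.single_le_sum (f := fun l => x i l) (fun l _ => h1 i l) (Finset.mem_univ j0))
      exact lt_of_lt_of_le (div_pos this (hmui i)) (hi0 i)
    have hSne : S.Nonempty := by
      have : 0 < ∑ l, x i0 l := by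
        rw [hM] at hMpos
        exact (div_pos_iff_of_pos_right (hmui i0)).1 hMpos
      obtain ⟨l, -, hl⟩ : ∃ l ∈ univ, 0 < x i0 l := by
        apply Finset.exists_lt_of_sum_lt
        simpa using this
      exact ⟨l, by simp only [hSdef, Finset.mem_filter, Finset.mem_univ, true_and]; exact ⟨i0, by simp [hA, hM], hl⟩⟩
    have hsub : univ.filter (fun i => ∃ j ∈ S, E i j) ⊆ A := by
      intro k hk
      obtain ⟨j, hj, hkj⟩ := (Finset.mem_filter.1 hk).2
      obtain ⟨i, hi, hij⟩ := (Finset.mem_filter.1 hj).2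
      have := h4 i j k hij hkj
      rw [(Finset.mem_filter.1 hi).2] at this
      exact Finset.mem_filter.2 ⟨Finset.mem_univ _, le_antisymm (hi0 k) this⟩
    have hkey : lam0 * M ≤ (lam0 * S.card) /
        ∑ i ∈ univ.filter (fun i => ∃ j ∈ S, E i j), mui i := by
      rw [le_div_iff₀ (hpos S hSne), mul_assoc]
      refine mul_le_mul_of_nonneg_left ?_ hlam0.le
      calc M * ∑ i ∈ univ.filter (fun i => ∃ j ∈ S, E i j), mui i
          ≤ M * ∑ i ∈ A, mui i := by
            refine mul_le_mul_of_nonneg_left ?_ hMpos.le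
            exact Finset.sum_le_sum_of_subset_of_nonneg hsub fun i _ _ => (hmui i).le
        _ = ∑ i ∈ A, ∑ l ∈ S, x i l := by
            rw [Finset.mul_sum]
            refine Finset.sum_congr rfl fun i hi => ?_
            rw [← (Finset.mem_filter.1 hi).2, div_mul_cancel₀ _ (hmui i).ne']
            symm
            apply Finset.sum_subset (Finset.subset_univ _)
            intro l _ hl
            by_contra hne
            exact hl (Finset.mem_filter.2 ⟨Finset.mem_univ _, i, hi,
              lt_of_le_of_ne (h1 i l) (Ne.symm hne)⟩)
        _ = ∑ l ∈ S, ∑ i ∈ A, x i l := Finset.sum_comm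
        _ ≤ ∑ l ∈ S, 1 := by
            refine Finset.sum_le_sum fun l _ => ?_
            rw [← h3 l]
            exact Finset.sum_le_sum_of_subset_of_nonneg (Finset.subset_univ _)
              fun i _ _ => h1 i l
        _ = S.card := by simp
    have hle : ∀ i, rho E lam mu x i ≤ lam0 * M := by
      intro i
      rw [hrho x h2]
      exact mul_le_mul_of_nonneg_left (hi0 i) hlam0.le
    have hM1 : lam0 * M ≤ 1 :=
      (hkey.trans (hlow x0 hx0 S hSne)).trans (ciSup_le hx0.2.2.2)
    have hfeas : Feasible E lam mu x := by
      refine ⟨h2, fun i j => ⟨h1 i j, ?_⟩, fun j => by rw [hcol x h2, h3], fun i => (hle i).trans hM1⟩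
      rw [← h3 j]
      exact Finset.single_le_sum (f := fun i => x i j) (fun i _ => h1 i j) (Finset.mem_univ i)
    have hη : etaS E lam mu ≤ ⨆ i, rho E lam mu x i := by
      apply csInf_le
      · refine ⟨(lam0 * S.card) / ∑ i ∈ univ.filter (fun i => ∃ j ∈ S, E i j), mui i, ?_⟩
        rintro _ ⟨z, hz, rfl⟩
        exact hlow z hz S hSne
      · exact ⟨x, hfeas, rfl⟩
    refine hη.trans ((ciSup_le hle).trans (hkey.trans ?_))
    exact le_ciSup (f := fun S : {S : Finset J // S.Nonempty} => (lam0 * S.1.card) /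
        ∑ i ∈ univ.filter (fun i => ∃ j ∈ S.1, E i j), mui i)
        (Set.finite_range _).bddAbove ⟨S, hSne⟩
  · rw [← hx0e]
    exact ciSup_le fun S => hlow x0 hx0 S.1 S.2
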